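/- arXiv:2507.18579 — 2 statements merged into one kernel-verified Lean document; each statement's English description precedes it below -/
import Mathlib

section
/- Let q = 2^s and m = 1. The ring of invariants of O_3(F_q) acting on F_q[y_1, x_1, z] (defining representation, quadratic form ξ_0 = z^2 + x_1 y_1) is the polynomial ring F_q[ξ_0, ξ_1, e_1], where ξ_1 = x_1 y_1^q + x_1^q y_1 and e_1 = ξ_1^{q/2−1} z + b_1 with b_1^2 = d_{1,1} + ξ_1^{q−2} ξ̄_0 (here d_{1,1} is the first Dickson invariant of GL_2(F_q) in x_1, y_1 and ξ̄_0 = x_1 y_1). -/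
open MvPolynomial

/-- Variable index set for `F_q[y_1,x_1,z]`: `none` is `z`,
`some (inl 0)` is `y_1`, `some (inr 0)` is `x_1`. -/
abbrev OIdx1 := Option (Fin 1 ⊕ Fin 1)

/-- The action of an invertible linear map `g` of `V = ι → F` on the polynomial
ring on `V`, so that `eval v (act g f) = eval (g v) f`. -/
noncomputable def act {F : Type*} [Field F] {ι : Type*} [Fintype ι] [DecidableEq ι]
    (g : (ι → F) ≃ₗ[F] (ι → F)) : MvPolynomial ι F →ₐ[F] MvPolynomial ι F :=
  MvPolynomial.aeval fun i => ∑ j, MvPolynomial.C (g (Pi.single j 1) i) * MvPolynomial.X j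

/-- The quadratic form `ξ_0 = z^2 + x_1 y_1`. -/
noncomputable def xiZero1 (F : Type*) [Field F] : MvPolynomial OIdx1 F :=
  X none ^ 2 + X (some (Sum.inr 0)) * X (some (Sum.inl 0))

/-- `ξ_1 = x_1 y_1^q + y_1 x_1^q`. -/
noncomputable def xiOne (q : ℕ) (F : Type*) [Field F] : MvPolynomial OIdx1 F :=
  X (some (Sum.inr 0)) * X (some (Sum.inl 0)) ^ q
    + X (some (Sum.inl 0)) * X (some (Sum.inr 0)) ^ q

/-- The product `Π_{v ∈ F_q^2} (t + ℓ_v)` over all linear forms in `x_1, y_1`: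
its coefficients are the Dickson invariants of `GL_2(F_q)` in `x_1, y_1`. -/
noncomputable def dicksonProd1 (F : Type*) [Field F] [Fintype F] :
    Polynomial (MvPolynomial OIdx1 F) :=
  ∏ c : (Fin 1 ⊕ Fin 1) → F,
    (Polynomial.X + Polynomial.C (∑ i, MvPolynomial.C (c i) * X (some i)))

section AdditivePolynomial

/-- The additive polynomial `∏_{c ∈ F_q} (Y + c x) = Y^q + x^(q-1) Y` in characteristic two. -/
noncomputable def orbitPoly {R : Type*} [CommRing R] (q : ℕ) (x : R) : Polynomial R :=
  Polynomial.X ^ q + Polynomial.C (x ^ (q - 1)) * Polynomial.X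

variable {F R : Type*} [Field F] [Fintype F] [CommRing R] [IsDomain R] [Algebra F R] [CharP R 2]
  {q : ℕ}

omit [IsDomain R] [CharP R 2] in
lemma orbitPoly_monic_natDegree [Nontrivial R] (hq : 2 ≤ q) (x : R) :
    (orbitPoly q x).Monic ∧ (orbitPoly q x).natDegree = q := by
  have hdeg : (Polynomial.C (x ^ (q - 1)) * Polynomial.X : Polynomial R).degree < q :=
    (Polynomial.degree_C_mul_X_le _).trans_lt (by exact_mod_cast (by omega : 1 < q))
  refine ⟨Polynomial.monic_X_pow_add hdeg, ?_⟩
  apply Polynomial.natDegree_eq_of_degree_eq_some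
  unfold orbitPoly
  rw [Polynomial.degree_add_eq_left_of_degree_lt, Polynomial.degree_X_pow]
  rwa [Polynomial.degree_X_pow]

omit [IsDomain R] in
lemma orbitPoly_eval_smul (hq : 2 ≤ q) (hF : Fintype.card F = q) (x : R) (c : F) :
    (orbitPoly q x).eval (c • x) = 0 := by
  obtain ⟨n, rfl⟩ : ∃ n, q = n + 1 := ⟨q - 1, by omega⟩
  have hc : c ^ (n + 1) = c := by rw [← hF]; exact FiniteField.pow_card c
  simp only [orbitPoly, Polynomial.eval_add, Polynomial.eval_pow, Polynomial.eval_X,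
    Polynomial.eval_mul, Polynomial.eval_C, smul_pow, hc, Nat.add_sub_cancel, mul_smul_comm,
    ← pow_succ, CharTwo.add_self_eq_zero]

omit [Fintype F] [CharP R 2] in
lemma smul_left_injective_of_isDomain {x : R} (hx : x ≠ 0) :
    Function.Injective fun c : F => c • x := by
  intro c d h
  have h' : algebraMap F R c * x = algebraMap F R d * x := by
    simpa [Algebra.smul_def] using h
  exact (algebraMap F R).injective (mul_right_cancel₀ hx h')

omit [CharP R 2] in
lemma eq_zero_of_eval_smul_eq_zero (hF : Fintype.card F = q) {x : R} (hx : x ≠ 0)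
    {r : Polynomial R} (hr : r.natDegree < q) (h : ∀ c : F, r.eval (c • x) = 0) : r = 0 :=
  Polynomial.eq_zero_of_natDegree_lt_card_of_eval_eq_zero r
    (smul_left_injective_of_isDomain (F := F) hx) h (by rwa [hF])

omit [CharP R 2] in
lemma natDegree_modByMonic_orbitPoly (hq : 2 ≤ q) (x : R) (f : Polynomial R) :
    (f %ₘ orbitPoly q x).natDegree < q := by
  obtain ⟨hm, hd⟩ := orbitPoly_monic_natDegree hq x
  have := Polynomial.natDegree_modByMonic_lt f hm (by
    intro h; rw [h, Polynomial.natDegree_one] at hd; omega)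
  rwa [hd] at this

lemma orbitPoly_dvd (hq : 2 ≤ q) (hF : Fintype.card F = q) {x : R} (hx : x ≠ 0)
    {f : Polynomial R} (h : ∀ c : F, f.eval (c • x) = 0) : orbitPoly q x ∣ f := by
  obtain ⟨hm, -⟩ := orbitPoly_monic_natDegree hq x
  rw [← Polynomial.modByMonic_eq_zero_iff_dvd hm]
  refine eq_zero_of_eval_smul_eq_zero hF hx (natDegree_modByMonic_orbitPoly hq x f) fun c => ?_
  have := congrArg (Polynomial.eval (c • x)) (Polynomial.modByMonic_add_div f (orbitPoly q x))
  simpa [orbitPoly_eval_smul hq hF, h] using this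

omit [IsDomain R] in
lemma orbitPoly_comp (hq : 2 ≤ q) {s : ℕ} (hs : q = 2 ^ s) (hF : Fintype.card F = q)
    (x : R) (c : F) :
    (orbitPoly q x).comp (Polynomial.X + Polynomial.C (c • x)) = orbitPoly q x := by
  have h := congrArg (Polynomial.C (R := R)) (orbitPoly_eval_smul hq hF x c)
  have hf : (Polynomial.X + Polynomial.C (c • x) : Polynomial R) ^ q
      = Polynomial.X ^ q + Polynomial.C (c • x) ^ q := by
    rw [hs]; exact add_pow_char_pow ..
  simp only [orbitPoly, Polynomial.eval_add, Polynomial.eval_pow, Polynomial.eval_X,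
    Polynomial.eval_mul, Polynomial.eval_C, map_add, map_mul, map_pow, map_zero] at h
  simp only [orbitPoly, Polynomial.add_comp, Polynomial.pow_comp, Polynomial.X_comp,
    Polynomial.mul_comp, Polynomial.C_comp, hf, map_pow]
  linear_combination h

/-- A polynomial fixed by all translations `Y ↦ Y + c x` is a polynomial in `Y^q + x^(q-1) Y`;
this is one step of the expansion. -/
lemma exists_eq_orbitPoly_mul_add_C (hq : 2 ≤ q) {s : ℕ} (hs : q = 2 ^ s)
    (hF : Fintype.card F = q) {x : R} (hx : x ≠ 0) {f : Polynomial R}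
    (h : ∀ c : F, f.comp (Polynomial.X + Polynomial.C (c • x)) = f) :
    ∃ (Q : Polynomial R) (r : R), f = orbitPoly q x * Q + Polynomial.C r ∧
      (∀ c : F, Q.comp (Polynomial.X + Polynomial.C (c • x)) = Q) := by
  obtain ⟨hm, hd⟩ := orbitPoly_monic_natDegree hq x
  have hmod := natDegree_modByMonic_orbitPoly hq x f
  have hfe := Polynomial.modByMonic_add_div f (orbitPoly q x)
  have key : ∀ c : F,
      (f /ₘ orbitPoly q x).comp (Polynomial.X + Polynomial.C (c • x)) = f /ₘ orbitPoly q x ∧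
      (f %ₘ orbitPoly q x).comp (Polynomial.X + Polynomial.C (c • x)) = f %ₘ orbitPoly q x := by
    intro c
    have hu := Polynomial.div_modByMonic_unique (f := f)
      ((f /ₘ orbitPoly q x).comp (Polynomial.X + Polynomial.C (c • x)))
      ((f %ₘ orbitPoly q x).comp (Polynomial.X + Polynomial.C (c • x))) hm ⟨?_, ?_⟩
    · exact ⟨hu.1.symm, hu.2.symm⟩
    · conv_rhs => rw [← h c, ← hfe]
      rw [Polynomial.add_comp, Polynomial.mul_comp, orbitPoly_comp hq hs hF]
    · apply Polynomial.degree_lt_degree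
      rw [hd, Polynomial.natDegree_comp, Polynomial.natDegree_X_add_C, mul_one]
      exact hmod
  refine ⟨f /ₘ orbitPoly q x, (f %ₘ orbitPoly q x).eval 0, ?_, fun c => (key c).1⟩
  have hr : f %ₘ orbitPoly q x - Polynomial.C ((f %ₘ orbitPoly q x).eval 0) = 0 := by
    refine eq_zero_of_eval_smul_eq_zero hF hx ?_ fun c => ?_
    · rwa [Polynomial.natDegree_sub_C]
    · have := congrArg (Polynomial.eval 0) (key c).2
      simp only [Polynomial.eval_comp, Polynomial.eval_add, Polynomial.eval_X,
        Polynomial.eval_C, zero_add] at this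
      simp [this]
  rw [← sub_eq_zero.mp hr, add_comm]
  exact hfe.symm

lemma dvd_of_coeff_map_ne_zero (hq : 2 ≤ q) {s : ℕ} (hs : q = 2 ^ s)
    (hF : Fintype.card F = q) {x : R} (hx : x ≠ 0) {R' : Type*} [CommRing R'] (π : R →+* R')
    (hπ : π x = 0) (f : Polynomial R)
    (h : ∀ c : F, f.comp (Polynomial.X + Polynomial.C (c • x)) = f) (n : ℕ)
    (hn : (f.map π).coeff n ≠ 0) : q ∣ n := by
  induction n using Nat.strong_induction_on generalizing f with
  | _ n ih =>
    obtain ⟨Q, r, rfl, hQ⟩ := exists_eq_orbitPoly_mul_add_C hq hs hF hx h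
    have hmap : (orbitPoly q x).map π = Polynomial.X ^ q := by
      simp [orbitPoly, hπ, zero_pow (by omega : q - 1 ≠ 0)]
    rw [Polynomial.map_add, Polynomial.map_mul, hmap, Polynomial.map_C, Polynomial.coeff_add,
      Polynomial.coeff_X_pow_mul', Polynomial.coeff_C] at hn
    rcases eq_or_ne n 0 with rfl | hn0
    · exact dvd_zero q
    · rw [if_neg hn0, add_zero] at hn
      by_cases hqn : q ≤ n
      · rw [if_pos hqn] at hn
        have := ih (n - q) (by omega) Q hQ hn
        exact (Nat.dvd_sub_iff_left hqn dvd_rfl).mp this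
      · rw [if_neg hqn] at hn
        exact absurd rfl hn

end AdditivePolynomial

section SpecialLinear

/-- The variables `x, η` are indexed by `some 0, some 1`, and `y` is indexed by `none`. -/
abbrev TwistIdx := Option (Fin 2)

/-- The action of the matrix `(a, b; c, d)` on `F[x, y, η]`, which fixes `η`. -/
noncomputable def slAct {F : Type*} [Field F] (a b c d : F) :
    MvPolynomial TwistIdx F →ₐ[F] MvPolynomial TwistIdx F :=
  aeval fun i : TwistIdx => i.elim (C c * X (some 0) + C d * X none)
    ![C a * X (some 0) + C b * X none, X (some 1)]

/-- The product of all lines in the span of `x, y`. -/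
noncomputable def lineProd (q : ℕ) (F : Type*) [Field F] : MvPolynomial TwistIdx F :=
  X (some 0) * X none ^ q + X (some 0) ^ q * X none

/-- The first Dickson invariant in `x, y`. -/
noncomputable def dicksonInv (q : ℕ) (F : Type*) [Field F] : MvPolynomial TwistIdx F :=
  X (some 0) ^ (q * (q - 1)) + (X none ^ q + X (some 0) ^ (q - 1) * X none) ^ (q - 1)

variable {F : Type*} [Field F]

@[simp] lemma slAct_X_none (a b c d : F) :
    slAct a b c d (X none) = C c * X (some 0) + C d * X none := by simp [slAct]

@[simp] lemma slAct_X_zero (a b c d : F) :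
    slAct a b c d (X (some 0)) = C a * X (some 0) + C b * X none := by simp [slAct]

@[simp] lemma slAct_X_one (a b c d : F) :
    slAct a b c d (X (some 1)) = X (some 1) := by simp [slAct]

lemma lineProd_eq_mul {q : ℕ} (hq : 2 ≤ q) : lineProd q F =
    X (some 0) * (X none ^ q + X (some 0) ^ (q - 1) * X none) := by
  obtain ⟨n, rfl⟩ : ∃ n, q = n + 1 := ⟨q - 1, by omega⟩
  simp only [lineProd, Nat.add_sub_cancel]
  ring

lemma optionEquivLeft_lineProd {q : ℕ} (hq : 2 ≤ q) : optionEquivLeft F (Fin 2) (lineProd q F) =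
    Polynomial.C (X 0) * orbitPoly q (X 0 : MvPolynomial (Fin 2) F) := by
  rw [lineProd_eq_mul hq]
  simp [orbitPoly]

lemma optionEquivLeft_dicksonInv (q : ℕ) : optionEquivLeft F (Fin 2) (dicksonInv q F) =
    Polynomial.C (X 0 ^ (q * (q - 1))) + orbitPoly q (X 0 : MvPolynomial (Fin 2) F) ^ (q - 1) := by
  simp [dicksonInv, orbitPoly]

lemma lineProd_ne_zero {q : ℕ} (hq : 2 ≤ q) : lineProd q F ≠ 0 := by
  refine ne_of_apply_ne (optionEquivLeft F (Fin 2)) ?_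
  rw [optionEquivLeft_lineProd hq, map_zero]
  exact mul_ne_zero (Polynomial.C_ne_zero.mpr (X_ne_zero 0))
    (orbitPoly_monic_natDegree hq _).1.ne_zero

variable [Fintype F] [CharP F 2] {q s : ℕ}

omit [CharP F 2] in
lemma C_pow_card (hF : Fintype.card F = q) {ι : Type*} (a : F) :
    (C a : MvPolynomial ι F) ^ q = C a := by
  rw [← C_pow, ← hF, FiniteField.pow_card]

lemma slAct_lineProd (hs : q = 2 ^ s) (hF : Fintype.card F = q) {a b c d : F}
    (h : a * d + b * c = 1) : slAct a b c d (lineProd q F) = lineProd q F := by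
  have hfr : ∀ u v : MvPolynomial TwistIdx F, (u + v) ^ q = u ^ q + v ^ q := by
    intro u v; rw [hs]; exact add_pow_char_pow ..
  have hC : (C a * C d + C b * C c : MvPolynomial TwistIdx F) = 1 := by
    rw [← C_mul, ← C_mul, ← C_add, h, C_1]
  simp only [lineProd, map_add, map_mul, map_pow, slAct_X_none, slAct_X_zero, hfr, mul_pow,
    C_pow_card hF]
  have h2 : (2 : MvPolynomial TwistIdx F) = 0 := CharTwo.two_eq_zero
  linear_combination (X (some 0) * X none ^ q + X (some 0) ^ q * X none) * hC
    + (C a * C c * X (some 0) * X (some 0) ^ q + C b * C d * X none * X none ^ q) * h2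

omit [Fintype F] in
lemma lineProd_mul_dicksonInv (hq : 2 ≤ q) (hs : q = 2 ^ s) : lineProd q F * dicksonInv q F =
    X (some 0) ^ (q * q) * X none + X (some 0) * X none ^ (q * q) := by
  have hfr : ∀ u v : MvPolynomial TwistIdx F, (u + v) ^ q = u ^ q + v ^ q := by
    intro u v; rw [hs]; exact add_pow_char_pow ..
  have h1 := hfr (X none ^ q) (X (some 0) ^ (q - 1) * X none)
  rw [lineProd_eq_mul hq, dicksonInv]
  have h2 : (2 : MvPolynomial TwistIdx F) = 0 := CharTwo.two_eq_zero
  obtain ⟨n, rfl⟩ : ∃ n, q = n + 1 := ⟨q - 1, by omega⟩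
  simp only [Nat.add_sub_cancel] at h1 ⊢
  linear_combination X (some 0) * h1
    + (X (some 0) ^ ((n + 1) * n + 1) * X none ^ (n + 1)) * h2

lemma slAct_dicksonInv (hq : 2 ≤ q) (hs : q = 2 ^ s) (hF : Fintype.card F = q) {a b c d : F}
    (h : a * d + b * c = 1) : slAct a b c d (dicksonInv q F) = dicksonInv q F := by
  have hfr : ∀ u v : MvPolynomial TwistIdx F, (u + v) ^ q = u ^ q + v ^ q := by
    intro u v; rw [hs]; exact add_pow_char_pow ..
  have hC : (C a * C d + C b * C c : MvPolynomial TwistIdx F) = 1 := by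
    rw [← C_mul, ← C_mul, ← C_add, h, C_1]
  apply mul_left_cancel₀ (lineProd_ne_zero (F := F) hq)
  conv_lhs => rw [← slAct_lineProd hs hF h]
  rw [← map_mul, lineProd_mul_dicksonInv hq hs]
  simp only [map_add, map_mul, map_pow, slAct_X_none, slAct_X_zero, pow_mul, hfr, mul_pow,
    C_pow_card hF]
  have h2 : (2 : MvPolynomial TwistIdx F) = 0 := CharTwo.two_eq_zero
  linear_combination (X (some 0) * (X none ^ q) ^ q + (X (some 0) ^ q) ^ q * X none) * hC
    + (C a * C c * X (some 0) * (X (some 0) ^ q) ^ q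
      + C b * C d * X none * (X none ^ q) ^ q) * h2

end SpecialLinear

section Dickson

variable {F : Type*} [Field F]

/-- Restriction of `F[x, η]` to the line `x = 0`. -/
noncomputable def restrictZero (F : Type*) [Field F] :
    MvPolynomial (Fin 2) F →+* MvPolynomial (Fin 2) F :=
  (aeval ![0, X 1] : MvPolynomial (Fin 2) F →ₐ[F] MvPolynomial (Fin 2) F).toRingHom

@[simp] lemma restrictZero_C (a : F) : restrictZero F (C a) = C a := by simp [restrictZero]

@[simp] lemma restrictZero_X_zero : restrictZero F (X 0) = 0 := by simp [restrictZero]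

@[simp] lemma restrictZero_X_one : restrictZero F (X 1) = X 1 := by simp [restrictZero]

lemma restrictZero_restrictZero (r : MvPolynomial (Fin 2) F) :
    restrictZero F (restrictZero F r) = restrictZero F r := by
  have : (restrictZero F).comp (restrictZero F) = restrictZero F := by
    apply ringHom_ext
    · simp
    · intro i
      fin_cases i <;> simp
  exact DFunLike.congr_fun this r

lemma X_zero_dvd_of_restrictZero_eq_zero {r : MvPolynomial (Fin 2) F}
    (h : restrictZero F r = 0) : X 0 ∣ r := by
  have key : ∀ p : MvPolynomial (Fin 2) F, X 0 ∣ p - restrictZero F p := by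
    intro p
    induction p using MvPolynomial.induction_on with
    | C a => simp [restrictZero]
    | add p p' hp hp' =>
      rw [map_add, add_sub_add_comm]
      exact dvd_add hp hp'
    | mul_X p i hp =>
      have : p * X i - restrictZero F (p * X i)
          = (p - restrictZero F p) * X i + restrictZero F p * (X i - restrictZero F (X i)) := by
        rw [map_mul]; ring
      rw [this]
      refine dvd_add (hp.mul_right _) (Dvd.dvd.mul_left ?_ _)
      fin_cases i <;> simp [restrictZero]
  simpa [h] using key r

lemma symm_C_restrictZero_mem (r : MvPolynomial (Fin 2) F)
    (A : Subalgebra F (MvPolynomial TwistIdx F)) (hA : X (some 1) ∈ A) :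
    (optionEquivLeft F (Fin 2)).symm (Polynomial.C (restrictZero F r)) ∈ A := by
  induction r using MvPolynomial.induction_on with
  | C a =>
    rw [restrictZero_C, optionEquivLeft_symm_C_C]
    exact A.algebraMap_mem a
  | add p p' hp hp' => simpa using A.add_mem hp hp'
  | mul_X p i hp =>
    rw [map_mul, map_mul, map_mul]
    refine A.mul_mem hp ?_
    fin_cases i
    · simp
    · simpa using hA

lemma optionEquivLeft_slAct_translation (c : F) (f : MvPolynomial TwistIdx F) :
    optionEquivLeft F (Fin 2) (slAct 1 0 c 1 f) =
      (optionEquivLeft F (Fin 2) f).comp (Polynomial.X + Polynomial.C (c • X 0)) := by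
  induction f using MvPolynomial.induction_on with
  | C a => simp [slAct]
  | add p p' hp hp' => simp only [map_add, hp, hp', Polynomial.add_comp]
  | mul_X p i hp =>
    have hX : optionEquivLeft F (Fin 2) (slAct 1 0 c 1 (X i)) =
        (optionEquivLeft F (Fin 2) (X i)).comp (Polynomial.X + Polynomial.C (c • X 0)) := by
      rcases i with _ | i
      · simp [smul_eq_C_mul, add_comm]
      · fin_cases i <;> simp
    simp only [map_mul, hp, hX, Polynomial.mul_comp]

lemma map_restrictZero_slAct_torus (a : F) (f : MvPolynomial TwistIdx F) :
    (optionEquivLeft F (Fin 2) (slAct a⁻¹ 0 0 a f)).map (restrictZero F) =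
      ((optionEquivLeft F (Fin 2) f).map (restrictZero F)).comp
        (Polynomial.C (C a) * Polynomial.X) := by
  induction f using MvPolynomial.induction_on with
  | C a => simp [slAct]
  | add p p' hp hp' => simp only [map_add, Polynomial.map_add, hp, hp', Polynomial.add_comp]
  | mul_X p i hp =>
    have hX : (optionEquivLeft F (Fin 2) (slAct a⁻¹ 0 0 a (X i))).map (restrictZero F) =
        ((optionEquivLeft F (Fin 2) (X i)).map (restrictZero F)).comp
          (Polynomial.C (C a) * Polynomial.X) := by
      rcases i with _ | i
      · simp
      · fin_cases i <;> simp
    simp only [map_mul, Polynomial.map_mul, hp, hX, Polynomial.mul_comp]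

lemma eval_zero_slAct_swap (f : MvPolynomial TwistIdx F) :
    (optionEquivLeft F (Fin 2) (slAct 0 1 1 0 f)).eval 0 =
      ((optionEquivLeft F (Fin 2) f).map (restrictZero F)).eval (X 0) := by
  induction f using MvPolynomial.induction_on with
  | C a => simp [slAct, restrictZero]
  | add p p' hp hp' => simp only [map_add, Polynomial.map_add, hp, hp', Polynomial.eval_add]
  | mul_X p i hp =>
    have hX : (optionEquivLeft F (Fin 2) (slAct 0 1 1 0 (X i))).eval 0 =
        ((optionEquivLeft F (Fin 2) (X i)).map (restrictZero F)).eval (X 0) := by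
      rcases i with _ | i
      · simp
      · fin_cases i <;> simp
    simp only [map_mul, Polynomial.map_mul, Polynomial.eval_mul, hp, hX]

variable [Fintype F] [CharP F 2] {q s : ℕ}

omit [Fintype F] [CharP F 2] in
lemma map_restrictZero_dicksonInv (hq : 2 ≤ q) :
    (optionEquivLeft F (Fin 2) (dicksonInv q F)).map (restrictZero F) =
      Polynomial.X ^ (q * (q - 1)) := by
  have h : q - 1 ≠ 0 := by omega
  have h' : q ≠ 0 := by omega
  simp [optionEquivLeft_dicksonInv, orbitPoly, h, h', pow_mul]

omit [Fintype F] [CharP F 2] in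
lemma natDegree_dicksonInv_le (hq : 2 ≤ q) :
    (optionEquivLeft F (Fin 2) (dicksonInv q F)).natDegree ≤ q * (q - 1) := by
  rw [optionEquivLeft_dicksonInv]
  refine Polynomial.natDegree_add_le_of_degree_le (by simp) ?_
  refine Polynomial.natDegree_pow_le.trans ?_
  rw [(orbitPoly_monic_natDegree hq _).2, mul_comm]

/-- The restriction of an invariant to `x = 0` is a polynomial in `y^(q(q-1))`. -/
lemma exists_map_restrictZero_eq_expand (hq : 2 ≤ q) (hs : q = 2 ^ s)
    (hF : Fintype.card F = q) {f : MvPolynomial TwistIdx F}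
    (h : ∀ a b c d : F, a * d + b * c = 1 → slAct a b c d f = f) :
    ∃ r : Polynomial (MvPolynomial (Fin 2) F), r.map (restrictZero F) = r ∧
      (optionEquivLeft F (Fin 2) f).map (restrictZero F) =
        Polynomial.expand _ (q * (q - 1)) r := by
  set p := (optionEquivLeft F (Fin 2) f).map (restrictZero F) with hp
  have hN : 0 < q * (q - 1) := Nat.mul_pos (by omega) (by omega)
  have hdvd : ∀ n, p.coeff n ≠ 0 → q * (q - 1) ∣ n := by
    intro n hn
    have h1 : q ∣ n := by
      refine dvd_of_coeff_map_ne_zero (F := F) (x := X 0) hq hs hF (X_ne_zero 0)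
        (restrictZero F) (by simp [restrictZero]) _ (fun c => ?_) n hn
      rw [← optionEquivLeft_slAct_translation, h _ _ _ _ (by simp)]
    have h2 : q - 1 ∣ n := by
      rw [← hF, ← FiniteField.forall_pow_eq_one_iff F]
      intro u
      have h3 := map_restrictZero_slAct_torus (u : F) f
      rw [h _ _ _ _ (by simp), ← hp] at h3
      have h4 := congrArg (fun t => Polynomial.coeff t n) h3
      simp only [Polynomial.comp_C_mul_X_coeff] at h4
      have h5 : p.coeff n * (C ((u : F) ^ n) - 1) = 0 := by
        rw [C_pow]; linear_combination -h4
      rcases mul_eq_zero.mp h5 with h6 | h6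
      · exact absurd h6 hn
      · ext
        rw [Units.val_pow_eq_pow_val, Units.val_one]
        exact C_injective TwistIdx F (by simpa using congrArg (rename some) (sub_eq_zero.mp h6))
    refine Nat.Coprime.mul_dvd_of_dvd_of_dvd ?_ h1 h2
    exact (Nat.coprime_self_sub_right (by omega)).mpr (Nat.coprime_one_right q)
  refine ⟨Polynomial.contract (q * (q - 1)) p, ?_, ?_⟩
  · ext1 n
    rw [Polynomial.coeff_map, Polynomial.coeff_contract hN.ne', hp, Polynomial.coeff_map]
    exact restrictZero_restrictZero _
  · ext1 n
    rw [Polynomial.coeff_expand hN]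
    split_ifs with hd
    · rw [Polynomial.coeff_contract hN.ne', Nat.div_mul_cancel hd]
    · by_contra hne
      exact hd (hdvd n hne)

/-- Every invariant agrees on `x = 0` with a polynomial in the Dickson invariant over `F[η]`. -/
lemma exists_mem_adjoin_map_restrictZero_eq (hq : 2 ≤ q) (hs : q = 2 ^ s)
    (hF : Fintype.card F = q) {f : MvPolynomial TwistIdx F}
    (h : ∀ a b c d : F, a * d + b * c = 1 → slAct a b c d f = f) :
    ∃ g ∈ Algebra.adjoin F {X (some 1), dicksonInv q F},
      (optionEquivLeft F (Fin 2) g).map (restrictZero F) =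
        (optionEquivLeft F (Fin 2) f).map (restrictZero F) ∧
      (optionEquivLeft F (Fin 2) g).natDegree ≤ (optionEquivLeft F (Fin 2) f).natDegree := by
  obtain ⟨r, hr, hf⟩ := exists_map_restrictZero_eq_expand hq hs hF h
  refine ⟨(optionEquivLeft F (Fin 2)).symm (r.comp (optionEquivLeft F (Fin 2) (dicksonInv q F))),
    ?_, ?_, ?_⟩
  · rw [← hr, Polynomial.comp, Polynomial.eval₂_eq_sum_range, map_sum]
    refine Subalgebra.sum_mem _ fun i _ => ?_
    rw [map_mul, map_pow, AlgEquiv.symm_apply_apply, Polynomial.coeff_map]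
    exact Subalgebra.mul_mem _
      (symm_C_restrictZero_mem _ _ (Algebra.subset_adjoin (by simp)))
      (Subalgebra.pow_mem _ (Algebra.subset_adjoin (by simp)) _)
  · rw [AlgEquiv.apply_symm_apply, hf, Polynomial.map_comp, hr, map_restrictZero_dicksonInv hq,
      Polynomial.expand_eq_comp_X_pow]
  · rw [AlgEquiv.apply_symm_apply]
    calc _ ≤ _ := Polynomial.natDegree_comp_le
      _ ≤ r.natDegree * (q * (q - 1)) := Nat.mul_le_mul_left _ (natDegree_dicksonInv_le hq)
      _ = _ := by rw [← Polynomial.natDegree_expand, ← hf]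
      _ ≤ _ := Polynomial.natDegree_map_le

/-- An invariant vanishing on `x = 0` vanishes on all lines. -/
lemma lineProd_dvd_of_map_restrictZero_eq_zero (hq : 2 ≤ q) (hF : Fintype.card F = q)
    {f : MvPolynomial TwistIdx F}
    (h : ∀ a b c d : F, a * d + b * c = 1 → slAct a b c d f = f)
    (h0 : (optionEquivLeft F (Fin 2) f).map (restrictZero F) = 0) :
    lineProd q F ∣ f := by
  have hev : (optionEquivLeft F (Fin 2) f).eval 0 = 0 := by
    have := eval_zero_slAct_swap f
    rwa [h _ _ _ _ (by simp), h0, Polynomial.eval_zero] at this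
  obtain ⟨k, hk⟩ : orbitPoly q (X 0) ∣ optionEquivLeft F (Fin 2) f := by
    refine orbitPoly_dvd (F := F) hq hF (X_ne_zero 0) fun c => ?_
    have := congrArg (Polynomial.eval 0) (optionEquivLeft_slAct_translation c f)
    rw [h _ _ _ _ (by simp), hev] at this
    simpa using this.symm
  have hk0 : k.map (restrictZero F) = 0 := by
    have hmap : (orbitPoly q (X 0)).map (restrictZero F) = Polynomial.X ^ q := by
      simp [orbitPoly, restrictZero, zero_pow (by omega : q - 1 ≠ 0)]
    rw [hk, Polynomial.map_mul, hmap] at h0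
    exact (mul_eq_zero.mp h0).resolve_left (pow_ne_zero _ Polynomial.X_ne_zero)
  obtain ⟨l, rfl⟩ : Polynomial.C (X 0) ∣ k := by
    rw [Polynomial.C_dvd_iff_dvd_coeff]
    intro n
    apply X_zero_dvd_of_restrictZero_eq_zero
    simpa using congrArg (fun t => Polynomial.coeff t n) hk0
  refine ⟨(optionEquivLeft F (Fin 2)).symm l, ?_⟩
  apply (optionEquivLeft F (Fin 2)).injective
  rw [map_mul, optionEquivLeft_lineProd hq, AlgEquiv.apply_symm_apply, hk]
  ring

/-- Dickson's theorem for `SL_2(F_q)`, with coefficients in `F[η]`. -/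
theorem mem_adjoin_of_slAct_invariant (hq : 2 ≤ q) (hs : q = 2 ^ s)
    (hF : Fintype.card F = q) (f : MvPolynomial TwistIdx F)
    (h : ∀ a b c d : F, a * d + b * c = 1 → slAct a b c d f = f) :
    f ∈ Algebra.adjoin F {X (some 1), lineProd q F, dicksonInv q F} := by
  induction hn : (optionEquivLeft F (Fin 2) f).natDegree using Nat.strong_induction_on
    generalizing f with
  | _ n ih =>
    obtain ⟨g, hg, hgf, hdeg⟩ := exists_mem_adjoin_map_restrictZero_eq hq hs hF h
    have hginv : ∀ a b c d : F, a * d + b * c = 1 → slAct a b c d g = g := by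
      intro a b c d hdet
      clear hgf hdeg
      induction hg using Algebra.adjoin_induction with
      | mem x hx =>
        rcases hx with rfl | rfl
        · simp
        · exact slAct_dicksonInv hq hs hF hdet
      | algebraMap r => simp
      | add x y _ _ hx hy => rw [map_add, hx, hy]
      | mul x y _ _ hx hy => rw [map_mul, hx, hy]
    have hgmem : g ∈ Algebra.adjoin F {X (some 1), lineProd q F, dicksonInv q F} :=
      Algebra.adjoin_mono (Set.insert_subset_insert (Set.subset_insert _ _)) hg
    obtain ⟨k, hk⟩ : lineProd q F ∣ f - g := by
      refine lineProd_dvd_of_map_restrictZero_eq_zero hq hF (fun a b c d hdet => ?_) ?_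
      · rw [map_sub, h a b c d hdet, hginv a b c d hdet]
      · rw [map_sub, Polynomial.map_sub, hgf, sub_self]
    have hkinv : ∀ a b c d : F, a * d + b * c = 1 → slAct a b c d k = k := by
      intro a b c d hdet
      apply mul_left_cancel₀ (lineProd_ne_zero (F := F) hq)
      conv_lhs => rw [← slAct_lineProd hs hF hdet]
      rw [← map_mul, ← hk, map_sub, h a b c d hdet, hginv a b c d hdet]
    have hf : f = g + lineProd q F * k := by rw [← hk]; ring
    rw [hf]
    refine Subalgebra.add_mem _ hgmem
      (Subalgebra.mul_mem _ (Algebra.subset_adjoin (by simp)) ?_)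
    rcases eq_or_ne k 0 with rfl | hk0
    · exact Subalgebra.zero_mem _
    refine ih _ ?_ k hkinv rfl
    have h1 : (optionEquivLeft F (Fin 2) (f - g)).natDegree
        = q + (optionEquivLeft F (Fin 2) k).natDegree := by
      obtain ⟨hm, hd⟩ := orbitPoly_monic_natDegree (R := MvPolynomial (Fin 2) F) hq (X 0)
      rw [hk, map_mul, optionEquivLeft_lineProd hq, mul_assoc,
        Polynomial.natDegree_C_mul (X_ne_zero 0), hm.natDegree_mul', hd]
      simpa using hk0
    have h2 : (optionEquivLeft F (Fin 2) (f - g)).natDegree ≤ n := by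
      rw [map_sub]
      exact (Polynomial.natDegree_sub_le _ _).trans (max_le hn.le (hdeg.trans hn.le))
    omega

end Dickson

section Twist

variable {F : Type*} [Field F]

/-- The embedding `x ↦ x^2`, `y ↦ y^2`, `z ↦ η + x y`, which turns the action of the orthogonal
group into an action of `SL_2` fixing `η`. -/
noncomputable def twist (F : Type*) [Field F] :
    MvPolynomial OIdx1 F →ₐ[F] MvPolynomial TwistIdx F :=
  aeval fun i : OIdx1 => i.elim (X (some 1) + X (some 0) * X none)
    (Sum.elim (fun _ => X none ^ 2) fun _ => X (some 0) ^ 2)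

@[simp] lemma twist_X_none : twist F (X none) = X (some 1) + X (some 0) * X none := by
  simp [twist]

@[simp] lemma twist_X_inl (i : Fin 1) : twist F (X (some (Sum.inl i))) = X none ^ 2 := by
  simp [twist]

@[simp] lemma twist_X_inr (i : Fin 1) : twist F (X (some (Sum.inr i))) = X (some 0) ^ 2 := by
  simp [twist]

/-- The classical Dickson invariant in the variables `x_1, y_1`, in closed form. -/
noncomputable def dicksonBase (q : ℕ) (F : Type*) [Field F] : MvPolynomial OIdx1 F :=
  X (some (Sum.inr 0)) ^ (q * (q - 1)) +
    (X (some (Sum.inl 0)) ^ q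
      + X (some (Sum.inr 0)) ^ (q - 1) * X (some (Sum.inl 0))) ^ (q - 1)

lemma prod_add_smul [Fintype F] {A : Type*} [CommRing A] [IsDomain A] [Algebra F A] [CharP A 2]
    {q : ℕ} (hq : 2 ≤ q) (hF : Fintype.card F = q) (u v : A) :
    ∏ c : F, (u + c • v) = u ^ q + v ^ (q - 1) * u := by
  rcases eq_or_ne v 0 with rfl | hv
  · simp [hF, zero_pow (by omega : q - 1 ≠ 0)]
  obtain ⟨hm, hd⟩ := orbitPoly_monic_natDegree hq v
  have hprod : (∏ c : F, (Polynomial.X - Polynomial.C (c • v))).natDegree = q := by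
    rw [Polynomial.natDegree_finsetProd_X_sub_C_eq_card, Finset.card_univ, hF]
  have hpm : (∏ c : F, (Polynomial.X - Polynomial.C (c • v))).Monic :=
    Polynomial.monic_prod_of_monic _ _ fun c _ => Polynomial.monic_X_sub_C _
  have h0 : (∏ c : F, (Polynomial.X - Polynomial.C (c • v))) - orbitPoly q v = 0 := by
    refine eq_zero_of_eval_smul_eq_zero hF hv ?_ fun c => ?_
    · rcases eq_or_ne ((∏ c : F, (Polynomial.X - Polynomial.C (c • v))) - orbitPoly q v) 0
        with h | h
      · rw [h, Polynomial.natDegree_zero]; omega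
      · rw [Polynomial.natDegree_lt_iff_degree_lt h]
        have := Polynomial.degree_sub_lt_left (p := ∏ c : F, (Polynomial.X - Polynomial.C (c • v)))
          (q := orbitPoly q v) ?_ hpm.ne_zero (by rw [hm.leadingCoeff, hpm.leadingCoeff])
        · rwa [Polynomial.degree_eq_natDegree hpm.ne_zero, hprod] at this
        · rw [Polynomial.degree_eq_natDegree hpm.ne_zero, hprod,
            Polynomial.degree_eq_natDegree hm.ne_zero, hd]
    · rw [Polynomial.eval_sub, orbitPoly_eval_smul hq hF, Polynomial.eval_prod,
        Finset.prod_eq_zero (Finset.mem_univ c) (by simp), sub_zero]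
  have h1 := congrArg (Polynomial.eval u) h0
  simp only [orbitPoly, Polynomial.eval_prod, Polynomial.eval_X,
    Polynomial.eval_C, Polynomial.eval_add, Polynomial.eval_pow, Polynomial.eval_mul,
    Polynomial.eval_zero, CharTwo.sub_eq_add] at h1
  rwa [← CharTwo.sub_eq_add, sub_eq_zero] at h1

lemma dicksonProd1_eq [Fintype F] [CharP F 2] {q s : ℕ} (hq : 2 ≤ q) (hs : q = 2 ^ s)
    (hF : Fintype.card F = q) : dicksonProd1 F =
      Polynomial.X ^ (q * q) + Polynomial.C (dicksonBase q F) * Polynomial.X ^ q +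
        Polynomial.C (xiOne q F ^ (q - 1)) * Polynomial.X := by
  set y : MvPolynomial OIdx1 F := X (some (Sum.inl 0)) with hy
  set x : MvPolynomial OIdx1 F := X (some (Sum.inr 0)) with hx
  have hfr : ∀ u v : Polynomial (MvPolynomial OIdx1 F), (u + v) ^ q = u ^ q + v ^ q := by
    intro u v; rw [hs]; exact add_pow_char_pow ..
  let M : Polynomial (MvPolynomial OIdx1 F) → Polynomial (MvPolynomial OIdx1 F) :=
    fun t => t ^ q + Polynomial.C x ^ (q - 1) * t
  have hMadd : ∀ (t u : Polynomial (MvPolynomial OIdx1 F)) (c : F),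
      M (t + c • u) = M t + c • M u := by
    intro t u c
    have hc : c ^ q = c := by rw [← hF]; exact FiniteField.pow_card c
    simp only [M, hfr, smul_pow, hc, smul_add, mul_add, mul_smul_comm]
    ring
  have h1 : dicksonProd1 F = ∏ p : F × F, (Polynomial.X + p.1 • Polynomial.C y
      + p.2 • Polynomial.C x) := by
    unfold dicksonProd1
    refine Fintype.prod_equiv ((Equiv.sumArrowEquivProdArrow _ _ _).trans
      ((Equiv.funUnique _ _).prodCongr (Equiv.funUnique _ _))) _ _ fun c => ?_
    simp [Fintype.sum_sum_type, hx, hy, add_assoc, MvPolynomial.smul_eq_C_mul,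
      Polynomial.smul_C]
  rw [h1, Fintype.prod_prod_type]
  simp only [prod_add_smul (F := F) hq hF]
  have h2 : ∀ c : F, (Polynomial.X + c • Polynomial.C y) ^ q + Polynomial.C x ^ (q - 1) *
      (Polynomial.X + c • Polynomial.C y) = M Polynomial.X + c • M (Polynomial.C y) :=
    fun c => hMadd _ _ _
  simp only [h2, prod_add_smul (F := F) hq hF]
  simp only [M, hfr, dicksonBase, xiOne, ← hx, ← hy]
  simp only [Polynomial.C_add, Polynomial.C_mul, Polynomial.C_pow]
  obtain ⟨n, rfl⟩ : ∃ n, q = n + 1 := ⟨q - 1, by omega⟩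
  simp only [Nat.add_sub_cancel]
  have h3 : (Polynomial.C x * Polynomial.C y ^ (n + 1) + Polynomial.C y * Polynomial.C x ^ (n + 1))
      = Polynomial.C x * (Polynomial.C y ^ (n + 1) + Polynomial.C x ^ n * Polynomial.C y) := by
    ring
  have h4 := mul_pow (Polynomial.C x)
    (Polynomial.C y ^ (n + 1) + Polynomial.C x ^ n * Polynomial.C y) n
  rw [h3, h4]
  ring

lemma dicksonProd1_coeff [Fintype F] [CharP F 2] {q s : ℕ} (hq : 2 ≤ q) (hs : q = 2 ^ s)
    (hF : Fintype.card F = q) : (dicksonProd1 F).coeff q = dicksonBase q F := by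
  rw [dicksonProd1_eq hq hs hF, Polynomial.coeff_add, Polynomial.coeff_add,
    Polynomial.coeff_X_pow, Polynomial.coeff_C_mul_X_pow, Polynomial.coeff_C_mul_X,
    if_neg (by nlinarith), if_pos rfl, if_neg (by omega), zero_add, add_zero]

lemma dicksonProd1_eval_X [Fintype F] (i : Fin 1 ⊕ Fin 1) :
    (dicksonProd1 F).eval (-X (some i)) = 0 := by
  rw [dicksonProd1, Polynomial.eval_prod]
  refine Finset.prod_eq_zero (Finset.mem_univ (Pi.single i 1)) ?_
  simp [Pi.single_apply]

variable [CharP F 2]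

lemma twist_injective : Function.Injective (twist F) := by
  let γ : MvPolynomial TwistIdx F →ₐ[F] MvPolynomial OIdx1 F :=
    aeval fun i : TwistIdx => i.elim (X (some (Sum.inl 0))) ![X (some (Sum.inr 0)), xiZero1 F]
  have h2 : (2 : MvPolynomial OIdx1 F) = 0 := CharTwo.two_eq_zero
  have h : γ.comp (twist F) = expand 2 := by
    apply algHom_ext
    intro i
    rcases i with _ | i | i
    · simp only [AlgHom.comp_apply, twist_X_none, expand_X]
      simp only [γ, map_add, map_mul, aeval_X, Option.elim, xiZero1, Matrix.cons_val_zero,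
        Matrix.cons_val_one]
      linear_combination X (some (Sum.inr 0)) * X (some (Sum.inl 0)) * h2
    · fin_cases i; simp [γ]
    · fin_cases i; simp [γ]
  intro f g hfg
  apply expand_injective (n := 2) two_pos
  rw [← h, AlgHom.comp_apply, AlgHom.comp_apply, hfg]

@[simp] lemma twist_xiZero1 : twist F (xiZero1 F) = X (some 1) ^ 2 := by
  have h2 : (2 : MvPolynomial TwistIdx F) = 0 := CharTwo.two_eq_zero
  simp only [xiZero1, map_add, map_mul, map_pow, twist_X_none, twist_X_inl, twist_X_inr]
  linear_combination (X (some 1) * X (some 0) * X none + X (some 0) ^ 2 * X none ^ 2) * h2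

@[simp] lemma twist_xiOne (q : ℕ) : twist F (xiOne q F) = lineProd q F ^ 2 := by
  simp only [xiOne, lineProd, map_add, map_mul, map_pow, twist_X_inl, twist_X_inr,
    CharTwo.add_sq]
  ring

lemma twist_dicksonBase (q : ℕ) : twist F (dicksonBase q F) = dicksonInv q F ^ 2 := by
  simp only [dicksonBase, dicksonInv, map_add, map_mul, map_pow, twist_X_inl, twist_X_inr,
    CharTwo.add_sq, pow_right_comm _ _ 2, mul_pow]

lemma twist_exceptional [Fintype F] {q s : ℕ} (h1s : 1 ≤ s) (hs : q = 2 ^ s)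
    (hF : Fintype.card F = q) {b : MvPolynomial OIdx1 F}
    (hb : b ^ 2 = (dicksonProd1 F).coeff q
      + xiOne q F ^ (q - 2) * (X (some (Sum.inr 0)) * X (some (Sum.inl 0)))) :
    twist F (xiOne q F ^ (2 ^ (s - 1) - 1) * X none + b) =
      (lineProd q F ^ 2) ^ (2 ^ (s - 1) - 1) * X (some 1) + dicksonInv q F := by
  obtain ⟨k, hk⟩ : ∃ k, 2 ^ (s - 1) = k + 1 :=
    ⟨2 ^ (s - 1) - 1, (Nat.sub_add_cancel Nat.one_le_two_pow).symm⟩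
  have hqk : q = 2 * k + 2 := by
    rw [hs, ← Nat.sub_add_cancel h1s, pow_succ, hk]; ring
  have hq : 2 ≤ q := by omega
  rw [dicksonProd1_coeff hq hs hF, show q - 2 = 2 * k by omega] at hb
  have hb' := congrArg (twist F) hb
  simp only [map_add, map_mul, map_pow, twist_dicksonBase, twist_xiOne, twist_X_inl,
    twist_X_inr] at hb'
  have h2 : (2 : MvPolynomial TwistIdx F) = 0 := CharTwo.two_eq_zero
  apply CharTwo.sq_injective
  simp only [hk, Nat.add_sub_cancel, map_add, map_mul, map_pow, twist_xiOne, twist_X_none,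
    CharTwo.add_sq, mul_pow, hb']
  linear_combination (lineProd q F ^ 2) ^ (2 * k) * X (some 0) ^ 2 * X none ^ 2 * h2

end Twist

section Orthogonal

variable {F : Type*} [Field F]

lemma eval_act {ι : Type*} [Fintype ι] [DecidableEq ι] (g : (ι → F) ≃ₗ[F] (ι → F)) (v : ι → F)
    (f : MvPolynomial ι F) : eval v (act g f) = eval (g v) f := by
  have h : (aeval v).comp (act g) = aeval (g v) := by
    apply algHom_ext
    intro i
    have hv : g v = ∑ j, v j • g (Pi.single j 1) := by
      conv_lhs => rw [pi_eq_sum_univ' v, map_sum]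
      simp
    rw [aeval_X, hv]
    simp [act, mul_comm]
  simpa [aeval_eq_eval] using DFunLike.congr_fun h f

/-- The substitutions through which `act g` is intertwined with `slAct a b c d`. -/
def Intertwines (g : (OIdx1 → F) ≃ₗ[F] (OIdx1 → F)) (a b c d : F) : Prop :=
  act g (X none) = X none + C (a * c) * X (some (Sum.inr 0)) + C (b * d) * X (some (Sum.inl 0)) ∧
  act g (X (some (Sum.inr 0))) =
    C (a ^ 2) * X (some (Sum.inr 0)) + C (b ^ 2) * X (some (Sum.inl 0)) ∧
  act g (X (some (Sum.inl 0))) =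
    C (c ^ 2) * X (some (Sum.inr 0)) + C (d ^ 2) * X (some (Sum.inl 0))

variable [CharP F 2]

lemma Intertwines.twist_act {g : (OIdx1 → F) ≃ₗ[F] (OIdx1 → F)} {a b c d : F}
    (hg : Intertwines g a b c d) (hdet : a * d + b * c = 1) (f : MvPolynomial OIdx1 F) :
    twist F (act g f) = slAct a b c d (twist F f) := by
  have h2 : (2 : MvPolynomial TwistIdx F) = 0 := CharTwo.two_eq_zero
  have hdet' : (C a * C d + C b * C c : MvPolynomial TwistIdx F) = 1 := by
    rw [← C_mul, ← C_mul, ← C_add, hdet, C_1]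
  obtain ⟨hz, hx, hy⟩ := hg
  have h : (twist F).comp (act g) = (slAct a b c d).comp (twist F) := by
    apply algHom_ext
    intro i
    have hC (r : F) : twist F (C r) = C r := (twist F).commutes r
    rcases i with _ | i | i
    · simp only [AlgHom.comp_apply, hz, map_add, map_mul, hC, twist_X_none, twist_X_inl,
        twist_X_inr, slAct_X_none, slAct_X_zero, slAct_X_one]
      linear_combination (-(X (some 0) * X none)) * hdet'
    · fin_cases i
      simp only [Fin.zero_eta, AlgHom.comp_apply, hy, map_add, map_mul, map_pow, hC,
        twist_X_inl, twist_X_inr, slAct_X_none]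
      linear_combination (-(C c * C d * X (some 0) * X none)) * h2
    · fin_cases i
      simp only [Fin.zero_eta, AlgHom.comp_apply, hx, map_add, map_mul, map_pow, hC,
        twist_X_inl, twist_X_inr, slAct_X_zero]
      linear_combination (-(C a * C b * X (some 0) * X none)) * h2
  exact DFunLike.congr_fun h f

/-- The linear endomorphism of `V` attached to a two by two matrix. -/
def slLinear (a b c d : F) : (OIdx1 → F) →ₗ[F] (OIdx1 → F) where
  toFun v i := i.elim (v none + a * c * v (some (Sum.inr 0)) + b * d * v (some (Sum.inl 0)))
    (Sum.elim (fun _ => c ^ 2 * v (some (Sum.inr 0)) + d ^ 2 * v (some (Sum.inl 0)))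
      fun _ => a ^ 2 * v (some (Sum.inr 0)) + b ^ 2 * v (some (Sum.inl 0)))
  map_add' v w := by
    funext i
    rcases i with _ | i | i <;> simp <;> ring
  map_smul' r v := by
    funext i
    rcases i with _ | i | i <;> simp <;> ring

lemma slLinear_comp_slLinear {a b c d : F} (hdet : a * d + b * c = 1) :
    slLinear a b c d ∘ₗ slLinear d b c a = LinearMap.id := by
  have h2 : (2 : F) = 0 := CharTwo.two_eq_zero
  have hsq : a ^ 2 * d ^ 2 + b ^ 2 * c ^ 2 = 1 := by
    have := congrArg (· ^ 2) hdet
    simpa [CharTwo.add_sq, mul_pow] using this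
  refine LinearMap.ext fun v => funext fun i => ?_
  rcases i with _ | i | i
  · simp only [slLinear, LinearMap.comp_apply, LinearMap.coe_mk, AddHom.coe_mk, Option.elim,
      Sum.elim_inl, Sum.elim_inr, LinearMap.id_apply]
    linear_combination (c * d * v (some (Sum.inr 0)) + a * b * v (some (Sum.inl 0))) * hdet
      + (c * d * v (some (Sum.inr 0)) + a * b * v (some (Sum.inl 0))) * h2
  · fin_cases i
    simp only [slLinear, LinearMap.comp_apply, LinearMap.coe_mk, AddHom.coe_mk, Option.elim,
      Sum.elim_inl, Sum.elim_inr, LinearMap.id_apply, Fin.zero_eta]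
    linear_combination v (some (Sum.inl 0)) * hsq + c ^ 2 * d ^ 2 * v (some (Sum.inr 0)) * h2
  · fin_cases i
    simp only [slLinear, LinearMap.comp_apply, LinearMap.coe_mk, AddHom.coe_mk, Option.elim,
      Sum.elim_inl, Sum.elim_inr, LinearMap.id_apply, Fin.zero_eta]
    linear_combination v (some (Sum.inr 0)) * hsq + a ^ 2 * b ^ 2 * v (some (Sum.inl 0)) * h2

lemma exists_intertwines {a b c d : F} (hdet : a * d + b * c = 1) :
    ∃ g : (OIdx1 → F) ≃ₗ[F] (OIdx1 → F), Intertwines g a b c d := by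
  refine ⟨LinearEquiv.ofLinearMap (slLinear a b c d) (slLinear d b c a)
    (slLinear_comp_slLinear hdet) (slLinear_comp_slLinear (by rw [← hdet]; ring)), ?_, ?_, ?_⟩ <;>
  simp [act, slLinear, Fintype.sum_option, Fintype.sum_sum_type, Pi.single_apply] <;> ring

lemma Intertwines.act_xiZero1 {g : (OIdx1 → F) ≃ₗ[F] (OIdx1 → F)} {a b c d : F}
    (hg : Intertwines g a b c d) (hdet : a * d + b * c = 1) :
    act g (xiZero1 F) = xiZero1 F := by
  apply twist_injective
  rw [hg.twist_act hdet, twist_xiZero1, map_pow, slAct_X_one]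

lemma exists_intertwines_of_act_xiZero1 [Finite F] {g : (OIdx1 → F) ≃ₗ[F] (OIdx1 → F)}
    (hg : act g (xiZero1 F) = xiZero1 F) :
    ∃ a b c d : F, a * d + b * c = 1 ∧ Intertwines g a b c d := by
  have h2 : (2 : F) = 0 := CharTwo.two_eq_zero
  have key (v : OIdx1 → F) : g v none ^ 2 + g v (some (Sum.inr 0)) * g v (some (Sum.inl 0)) =
      v none ^ 2 + v (some (Sum.inr 0)) * v (some (Sum.inl 0)) := by
    have := congrArg (eval v) hg
    rw [eval_act] at this
    simpa [xiZero1] using this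
  have kz := key (Pi.single none 1)
  have kx := key (Pi.single (some (Sum.inr 0)) 1)
  have ky := key (Pi.single (some (Sum.inl 0)) 1)
  have kzx := key (Pi.single none 1 + Pi.single (some (Sum.inr 0)) 1)
  have kzy := key (Pi.single none 1 + Pi.single (some (Sum.inl 0)) 1)
  have kxy := key (Pi.single (some (Sum.inr 0)) 1 + Pi.single (some (Sum.inl 0)) 1)
  simp only [map_add, Pi.add_apply] at kzx kzy kxy
  have hrow (i : OIdx1) : act g (X i) = C (g (Pi.single none 1) i) * X none
      + (C (g (Pi.single (some (Sum.inr 0)) 1) i) * X (some (Sum.inr 0))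
      + C (g (Pi.single (some (Sum.inl 0)) 1) i) * X (some (Sum.inl 0))) := by
    simp [act, Fintype.sum_option, Fintype.sum_sum_type, add_comm]
  unfold Intertwines
  rw [hrow, hrow, hrow]
  generalize g (Pi.single none 1) = u at *
  generalize g (Pi.single (some (Sum.inr 0)) 1) = v at *
  generalize g (Pi.single (some (Sum.inl 0)) 1) = w at *
  have sqrt (r : F) : ∃ a, r = a ^ 2 := by
    obtain ⟨a, ha⟩ := FiniteField.isSquare_of_char_two (ringChar.eq F 2) r
    exact ⟨a, by rw [ha, sq]⟩
  obtain ⟨a, ha⟩ := sqrt (v (some (Sum.inr 0)))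
  obtain ⟨b, hb⟩ := sqrt (w (some (Sum.inr 0)))
  obtain ⟨c, hc⟩ := sqrt (v (some (Sum.inl 0)))
  obtain ⟨d, hd⟩ := sqrt (w (some (Sum.inl 0)))
  simp [CharTwo.add_sq] at kz kx ky kzx kzy kxy
  rw [ha, hb, hc, hd] at *
  generalize u none = uz at *
  generalize v none = vz at *
  generalize w none = wz at *
  generalize u (some (Sum.inl 0)) = uy at *
  generalize u (some (Sum.inr 0)) = ux at *
  have e1 : ux * c ^ 2 + a ^ 2 * uy = 0 := by linear_combination kzx - kz - kx
  have e2 : ux * d ^ 2 + b ^ 2 * uy = 0 := by linear_combination kzy - kz - ky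
  have e3 : a ^ 2 * d ^ 2 + b ^ 2 * c ^ 2 = 1 := by linear_combination kxy - kx - ky
  have hux : ux = 0 := by
    linear_combination -ux * e3 + a ^ 2 * e2 + b ^ 2 * e1 - a ^ 2 * b ^ 2 * uy * h2
  have huy : uy = 0 := by
    linear_combination -uy * e3 + d ^ 2 * e1 + c ^ 2 * e2 - c ^ 2 * d ^ 2 * ux * h2
  subst hux huy
  refine ⟨a, b, c, d, ?_, ?_, ?_, ?_⟩
  · apply CharTwo.sq_injective
    simp only [CharTwo.add_sq, mul_pow, e3, one_pow]
  · have hz : uz = 1 := CharTwo.sq_injective (by simpa using kz)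
    have hv : vz = a * c := CharTwo.sq_injective (by
      simp only; linear_combination kx - a ^ 2 * c ^ 2 * h2)
    have hw : wz = b * d := CharTwo.sq_injective (by
      simp only; linear_combination ky - b ^ 2 * d ^ 2 * h2)
    rw [hz, hv, hw, C_1, one_mul, add_assoc]
  · simp
  · simp

end Orthogonal

section Descent

lemma exists_four_term_of_mem_adjoin {R B : Type*} [CommRing R] [CommRing B] [Algebra R B]
    {A : Subalgebra R B} {u v w p : B} (hu : u ^ 2 ∈ A) (hv : v ^ 2 ∈ A) (hp : p ∈ A)
    (hw : p * u + w ∈ A) {f : B} (hf : f ∈ Algebra.adjoin R {u, v, w}) :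
    ∃ a₀ ∈ A, ∃ a₁ ∈ A, ∃ a₂ ∈ A, ∃ a₃ ∈ A, f = a₀ + a₁ * u + a₂ * v + a₃ * (u * v) := by
  induction hf using Algebra.adjoin_induction with
  | mem x hx =>
    rcases hx with rfl | rfl | rfl
    · exact ⟨0, zero_mem _, 1, one_mem _, 0, zero_mem _, 0, zero_mem _, by ring⟩
    · exact ⟨0, zero_mem _, 0, zero_mem _, 1, one_mem _, 0, zero_mem _, by ring⟩
    · exact ⟨_, hw, -p, neg_mem hp, 0, zero_mem _, 0, zero_mem _, by ring⟩
  | algebraMap r =>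
    exact ⟨_, A.algebraMap_mem r, 0, zero_mem _, 0, zero_mem _, 0, zero_mem _, by ring⟩
  | add x y _ _ hx hy =>
    obtain ⟨a₀, h₀, a₁, h₁, a₂, h₂, a₃, h₃, rfl⟩ := hx
    obtain ⟨b₀, k₀, b₁, k₁, b₂, k₂, b₃, k₃, rfl⟩ := hy
    exact ⟨_, add_mem h₀ k₀, _, add_mem h₁ k₁, _, add_mem h₂ k₂, _, add_mem h₃ k₃, by ring⟩
  | mul x y _ _ hx hy =>
    obtain ⟨a₀, h₀, a₁, h₁, a₂, h₂, a₃, h₃, rfl⟩ := hx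
    obtain ⟨b₀, k₀, b₁, k₁, b₂, k₂, b₃, k₃, rfl⟩ := hy
    refine ⟨a₀ * b₀ + u ^ 2 * (a₁ * b₁) + v ^ 2 * (a₂ * b₂) + u ^ 2 * (v ^ 2 * (a₃ * b₃)), ?_,
      a₀ * b₁ + a₁ * b₀ + v ^ 2 * (a₂ * b₃ + a₃ * b₂), ?_,
      a₀ * b₂ + a₂ * b₀ + u ^ 2 * (a₁ * b₃ + a₃ * b₁), ?_,
      a₀ * b₃ + a₃ * b₀ + (a₁ * b₂ + a₂ * b₁), ?_, by ring⟩ <;>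
    repeat first | assumption | apply add_mem | apply mul_mem

variable {F : Type*} [Field F] [CharP F 2]

lemma derivation_twist_eq_zero
    (D : Derivation F (MvPolynomial TwistIdx F) (MvPolynomial TwistIdx F))
    (hD : D (X (some 1)) = X none * D (X (some 0)) + X (some 0) * D (X none))
    (f : MvPolynomial OIdx1 F) : D (twist F f) = 0 := by
  have h2 : (2 : MvPolynomial TwistIdx F) = 0 := CharTwo.two_eq_zero
  have hX (i : OIdx1) : D (twist F (X i)) = 0 := by
    rcases i with _ | i | i
    · rw [twist_X_none, map_add, Derivation.leibniz, hD, smul_eq_mul, smul_eq_mul]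
      linear_combination (X none * D (X (some 0)) + X (some 0) * D (X none)) * h2
    · rw [twist_X_inl, sq, Derivation.leibniz, smul_eq_mul]
      linear_combination X none * D (X none) * h2
    · rw [twist_X_inr, sq, Derivation.leibniz, smul_eq_mul]
      linear_combination X (some 0) * D (X (some 0)) * h2
  induction f using MvPolynomial.induction_on with
  | C r => exact (congrArg D ((twist F).commutes r)).trans (D.map_algebraMap r)
  | add f g hf hg => rw [map_add, map_add, hf, hg, add_zero]
  | mul_X f i hf => rw [map_mul, Derivation.leibniz, hf, hX, smul_zero, smul_zero, add_zero]

lemma four_term_eq_of_mem_range_twist {q s : ℕ} (hq : 2 ≤ q) (hs : q = 2 ^ s)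
    {a₀ a₁ a₂ a₃ : MvPolynomial TwistIdx F} (h₀ : a₀ ∈ (twist F).range)
    (h₁ : a₁ ∈ (twist F).range) (h₂ : a₂ ∈ (twist F).range) (h₃ : a₃ ∈ (twist F).range)
    (h : a₀ + a₁ * X (some 1) + a₂ * lineProd q F + a₃ * (X (some 1) * lineProd q F)
      ∈ (twist F).range) :
    a₀ + a₁ * X (some 1) + a₂ * lineProd q F + a₃ * (X (some 1) * lineProd q F) = a₀ := by
  have h2 : (2 : MvPolynomial TwistIdx F) = 0 := CharTwo.two_eq_zero
  have hqz : (q : MvPolynomial TwistIdx F) = 0 := by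
    rw [hs, Nat.cast_pow, Nat.cast_ofNat, h2, zero_pow]
    rintro rfl
    simp at hs
    omega
  have main (D : Derivation F (MvPolynomial TwistIdx F) (MvPolynomial TwistIdx F))
      (hD : D (X (some 1)) = X none * D (X (some 0)) + X (some 0) * D (X none)) :
      D (lineProd q F) = X none ^ q * D (X (some 0)) + X (some 0) ^ q * D (X none) ∧
      ∀ a ∈ (twist F).range, D a = 0 := by
    refine ⟨?_, ?_⟩
    · simp [lineProd, Derivation.leibniz, Derivation.leibniz_pow, hqz]
    · rintro _ ⟨f, rfl⟩
      exact derivation_twist_eq_zero D hD f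
  obtain ⟨D, hDx, hDy, hDz⟩ :
      ∃ D : Derivation F (MvPolynomial TwistIdx F) (MvPolynomial TwistIdx F),
        D (X (some 0)) = 1 ∧ D (X none) = 0 ∧ D (X (some 1)) = X none :=
    ⟨mkDerivation F fun i : TwistIdx => i.elim 0 ![1, X none], by simp, by simp, by simp⟩
  obtain ⟨E, hEx, hEy, hEz⟩ :
      ∃ E : Derivation F (MvPolynomial TwistIdx F) (MvPolynomial TwistIdx F),
        E (X (some 0)) = 0 ∧ E (X none) = 1 ∧ E (X (some 1)) = X (some 0) :=
    ⟨mkDerivation F fun i : TwistIdx => i.elim 1 ![0, X (some 0)], by simp, by simp, by simp⟩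
  obtain ⟨hDL, hDr⟩ := main D (by simp [hDx, hDy, hDz])
  obtain ⟨hEL, hEr⟩ := main E (by simp [hEx, hEy, hEz])
  have eD := hDr _ h
  have eE := hEr _ h
  simp only [map_add, Derivation.leibniz, hDr _ h₀, hDr _ h₁, hDr _ h₂, hDr _ h₃, hDL, hDx, hDy,
    hDz, smul_eq_mul] at eD
  simp only [map_add, Derivation.leibniz, hEr _ h₀, hEr _ h₁, hEr _ h₂, hEr _ h₃, hEL, hEx, hEy,
    hEz, smul_eq_mul] at eE
  have hL := lineProd_ne_zero (F := F) hq
  have hy : (X none : MvPolynomial TwistIdx F) ≠ 0 := X_ne_zero _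
  have e₂ : a₂ = a₃ * X (some 1) := by
    rw [← sub_eq_zero]
    refine (mul_eq_zero.mp (?_ : (a₂ - a₃ * X (some 1)) * lineProd q F = 0)).resolve_right hL
    have : lineProd q F = X (some 0) * X none ^ q + X (some 0) ^ q * X none := rfl
    linear_combination X (some 0) * eD + X none * eE + (a₂ + a₃ * X (some 1)) * this
      - (a₃ * X (some 1) * lineProd q F + X (some 0) * X none * (a₁ + a₃ * lineProd q F)) * h2
  have e₃ : a₃ = 0 := by
    have := congrArg D e₂
    simpa [Derivation.leibniz, hDr _ h₂, hDr _ h₃, hDz, hy] using this.symm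
  have e₁ : a₁ = 0 := by
    subst e₃
    simpa [e₂, hy] using eD
  simp [e₁, e₂, e₃]

end Descent

section AlgebraicIndependence

variable {F : Type*} [Field F]

lemma isIntegral_X_of_mem [Fintype F] [CharP F 2] {q s : ℕ} (hq : 2 ≤ q) (hs : q = 2 ^ s) (hF : Fintype.card F = q)
    {A : Subalgebra F (MvPolynomial OIdx1 F)} (h0 : xiZero1 F ∈ A) (h1 : xiOne q F ∈ A)
    (hd : dicksonBase q F ∈ A) (i : OIdx1) : IsIntegral A (X i : MvPolynomial OIdx1 F) := by
  have hsome (i : Fin 1 ⊕ Fin 1) : IsIntegral A (X (some i) : MvPolynomial OIdx1 F) := by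
    have hroot := dicksonProd1_eval_X (F := F) i
    rw [dicksonProd1_eq hq hs hF, CharTwo.neg_eq] at hroot
    let r : Polynomial A := Polynomial.C ⟨_, hd⟩ * Polynomial.X ^ q +
      Polynomial.C (⟨_, h1⟩ ^ (q - 1)) * Polynomial.X
    refine ⟨Polynomial.X ^ (q * q) + r, Polynomial.monic_X_pow_add ?_, ?_⟩
    · refine (Polynomial.degree_add_le _ _).trans_lt (max_lt ?_ ?_)
      · refine (Polynomial.degree_C_mul_X_pow_le _ _).trans_lt ?_
        exact_mod_cast (by nlinarith : q < q * q)
      · refine (Polynomial.degree_C_mul_X_le _).trans_lt ?_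
        exact_mod_cast (by nlinarith : 1 < q * q)
    · rw [← hroot]
      simp [r, Polynomial.eval₂_add, Polynomial.eval₂_mul, add_assoc]
  rcases i with _ | i
  · refine IsIntegral.of_pow two_pos ?_
    have : (X none : MvPolynomial OIdx1 F) ^ 2 =
        algebraMap A _ ⟨_, h0⟩ - X (some (Sum.inr 0)) * X (some (Sum.inl 0)) := by
      simp [xiZero1]
    rw [this]
    exact isIntegral_algebraMap.sub ((hsome _).mul (hsome _))
  · exact hsome i

lemma algebraicIndependent_of_isIntegral {x : Fin 3 → MvPolynomial OIdx1 F}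
    (h : ∀ i, IsIntegral (Algebra.adjoin F (Set.range x)) (X i : MvPolynomial OIdx1 F)) :
    AlgebraicIndependent F x := by
  have hint : Algebra.IsIntegral (Algebra.adjoin F (Set.range x)) (MvPolynomial OIdx1 F) := by
    refine ⟨fun p => ?_⟩
    induction p using MvPolynomial.induction_on with
    | C r =>
      exact isIntegral_algebraMap (R := Algebra.adjoin F (Set.range x))
        (x := algebraMap F (Algebra.adjoin F (Set.range x)) r)
    | add f g hf hg => exact hf.add hg
    | mul_X f i hf => exact hf.mul (h i)
  have halg : Algebra.IsAlgebraic (Algebra.adjoin F (Set.range x)) (MvPolynomial OIdx1 F) :=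
    inferInstance
  refine (Algebra.IsAlgebraic.isTranscendenceBasis_of_lift_le_trdeg_of_finite F x ?_).1
  rw [MvPolynomial.trdeg_of_isDomain]
  simp

end AlgebraicIndependence

/-- The invariant ring of `O_3(F_q)` is the polynomial ring `F_q[ξ_0, ξ_1, e_1]`,
where `e_1 = ξ_1^{q/2-1} z + b_1` with `b_1^2 = d_{1,1} + ξ_1^{q-2} ξ̄_0`. -/
theorem stmt_12 {F : Type*} [Field F] [Fintype F] (s q : ℕ) (hs : 1 ≤ s)
    (hq : q = 2 ^ s) (hF : Fintype.card F = q)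
    (b1 : MvPolynomial OIdx1 F)
    (hb1 : b1 ^ 2 = (dicksonProd1 F).coeff q
      + xiOne q F ^ (q - 2) * (X (some (Sum.inr 0)) * X (some (Sum.inl 0)))) :
    (∀ f : MvPolynomial OIdx1 F,
      (∀ g : (OIdx1 → F) ≃ₗ[F] (OIdx1 → F),
        act g (xiZero1 F) = xiZero1 F → act g f = f) ↔
      f ∈ Algebra.adjoin F {xiZero1 F, xiOne q F,
        xiOne q F ^ (2 ^ (s - 1) - 1) * X none + b1}) ∧
    AlgebraicIndependent F
      ![xiZero1 F, xiOne q F, xiOne q F ^ (2 ^ (s - 1) - 1) * X none + b1] := by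
  have : CharP F 2 := charP_of_card_eq_prime_pow (hF.trans hq)
  have h2q : 2 ≤ q := hq ▸ Nat.le_self_pow (by omega) 2
  have htw := twist_exceptional hs hq hF hb1
  set e := xiOne q F ^ (2 ^ (s - 1) - 1) * X none + b1 with he
  set k := 2 ^ (s - 1) - 1
  set A := Algebra.adjoin F {xiZero1 F, xiOne q F, e} with hA
  have h0 : xiZero1 F ∈ A := Algebra.subset_adjoin (by simp)
  have h1 : xiOne q F ∈ A := Algebra.subset_adjoin (by simp)
  have hE : e ∈ A := Algebra.subset_adjoin (by simp)
  refine ⟨fun f => ⟨fun hf => ?_, fun hf g hg => ?_⟩, ?_⟩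
  · have hmem := mem_adjoin_of_slAct_invariant h2q hq hF (twist F f) fun a b c d hdet => by
      obtain ⟨g, hg⟩ := exists_intertwines hdet
      rw [← hg.twist_act hdet, hf g (hg.act_xiZero1 hdet)]
    obtain ⟨a₀, h₀, a₁, h₁, a₂, h₂, a₃, h₃, hsum⟩ :=
      exists_four_term_of_mem_adjoin (A := A.map (twist F)) (p := (lineProd q F ^ 2) ^ k)
        ⟨_, h0, twist_xiZero1⟩ ⟨_, h1, twist_xiOne q⟩
        ⟨_, pow_mem h1 k, by simp⟩ ⟨_, hE, htw⟩ hmem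
    have hle (a) (ha : a ∈ A.map (twist F)) : a ∈ (twist F).range := by
      obtain ⟨b, -, rfl⟩ := ha
      exact ⟨b, rfl⟩
    have h4 := four_term_eq_of_mem_range_twist h2q hq (hle _ h₀) (hle _ h₁) (hle _ h₂) (hle _ h₃)
      (hsum ▸ ⟨f, rfl⟩)
    obtain ⟨f', hf', rfl⟩ := h₀
    rwa [← twist_injective (hsum.trans h4)] at hf'
  · obtain ⟨a, b, c, d, hdet, hI⟩ := exists_intertwines_of_act_xiZero1 hg
    have hle : A ≤ AlgHom.equalizer (act g) (AlgHom.id F _) := by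
      rw [hA, Algebra.adjoin_le_iff]
      rintro x (rfl | rfl | rfl)
      · exact hg
      · apply twist_injective
        rw [hI.twist_act hdet, AlgHom.id_apply, twist_xiOne, map_pow, slAct_lineProd hq hF hdet]
      · apply twist_injective
        rw [hI.twist_act hdet, AlgHom.id_apply, htw, map_add, map_mul, map_pow, map_pow,
          slAct_lineProd hq hF hdet, slAct_X_one, slAct_dicksonInv h2q hq hF hdet]
    exact hle hf
  · apply algebraicIndependent_of_isIntegral
    have hrange : Set.range ![xiZero1 F, xiOne q F, e] = {xiZero1 F, xiOne q F, e} := by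
      rw [Matrix.range_cons, Matrix.range_cons, Matrix.range_cons, Matrix.range_empty,
        Set.union_empty, Set.singleton_union, Set.singleton_union]
    rw [hrange]
    refine isIntegral_X_of_mem h2q hq hF h0 h1 ?_
    have : dicksonBase q F = e ^ 2 - (xiOne q F ^ k) ^ 2 * xiZero1 F := by
      apply twist_injective
      have h2 : (2 : MvPolynomial TwistIdx F) = 0 := CharTwo.two_eq_zero
      simp only [twist_dicksonBase, map_sub, map_mul, map_pow, htw, twist_xiOne, twist_xiZero1]
      linear_combination (-((lineProd q F ^ 2) ^ k * X (some 1) * dicksonInv q F)) * h2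
    rw [this]
    exact sub_mem (pow_mem hE 2) (mul_mem (pow_mem (pow_mem h1 k) 2) h0)
end

section
/- Let q = 2^s with q > 2. The invariant ring F_q[y_1,y_2,z,x_2,x_1]^{O_5(F_q)} satisfies the relation ξ_3^{q/2} = ξ_2^{q/2} e_1 + ξ_1^{q/2} e_2 + u_2^{q/2−1} ξ_1^{q^2/2+1}, where e_1 = u_2^{q/2−1} ξ_1^{q/2} z + b_1, e_2 = u_2^{q/2−1} ξ_2^{q/2} z + b_2, b_1^2 = d_{1,2} + u_2^{q−2}(ξ_1ξ_2 + ξ̄_0 ξ_1^q), b_2^2 = d_{2,2} + u_2^{q−2}(ξ_1ξ_3 + ξ̄_0 ξ_2^q), and u_2 = ξ_3ξ_1^q + ξ_2^{q+1} + ξ_1^{q^2+1}. -/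
open MvPolynomial

/-- Variable index set for `S_2[z] = F_q[y_1,y_2,x_2,x_1,z]`:
`none` is `z`, `some (inl j)` is `y_j`, `some (inr j)` is `x_j`. -/
abbrev OIdx2 := Option (Fin 2 ⊕ Fin 2)

/-- `ξ_i = Σ_j (x_j y_j^{q^i} + y_j x_j^{q^i})` for `i ≥ 1`. -/
noncomputable def xiG (q : ℕ) (F : Type*) [Field F] (i : ℕ) : MvPolynomial OIdx2 F :=
  ∑ j : Fin 2, (X (some (Sum.inr j)) * X (some (Sum.inl j)) ^ q ^ i
    + X (some (Sum.inl j)) * X (some (Sum.inr j)) ^ q ^ i)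

/-- `ξ̄_0 = x_1 y_1 + x_2 y_2`. -/
noncomputable def xiB (F : Type*) [Field F] : MvPolynomial OIdx2 F :=
  ∑ j : Fin 2, X (some (Sum.inr j)) * X (some (Sum.inl j))

/-- `u_2 = ξ_3 ξ_1^q + ξ_2^{q+1} + ξ_1^{q^2+1}`. -/
noncomputable def u2 (q : ℕ) (F : Type*) [Field F] : MvPolynomial OIdx2 F :=
  xiG q F 3 * xiG q F 1 ^ q + xiG q F 2 ^ (q + 1) + xiG q F 1 ^ (q ^ 2 + 1)

/-- The product `Π_{v ∈ F_q^4} (t + ℓ_v)` over all linear forms in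
`x_1,x_2,y_2,y_1`; its coefficient of `t^{q^{4-i}}` is the Dickson invariant
`d_{i,2}` of `GL_4(F_q)`. -/
noncomputable def dickP (F : Type*) [Field F] [Fintype F] :
    Polynomial (MvPolynomial OIdx2 F) :=
  ∏ c : (Fin 2 ⊕ Fin 2) → F,
    (Polynomial.X + Polynomial.C (∑ i, MvPolynomial.C (c i) * X (some i)))

/-- The symplectic form of the `i`-th and `j`-th vectors of a sequence, up to signs, which do not
matter in characteristic two. -/
def sympForm {R : Type*} [CommRing R] (w : Fin 2 ⊕ Fin 2 → ℕ → R) (i j : ℕ) : R :=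
  ∑ k : Fin 2, (w (Sum.inr k) i * w (Sum.inl k) j + w (Sum.inl k) i * w (Sum.inr k) j)

/-- The Pfaffian of the Gram matrix of four vectors of a sequence, up to signs. -/
def sympPf {R : Type*} [CommRing R] (w : Fin 2 ⊕ Fin 2 → ℕ → R) (i j k l : ℕ) : R :=
  sympForm w i j * sympForm w k l + sympForm w i k * sympForm w j l
    + sympForm w i l * sympForm w j k

lemma sympPf_linear_relation {R : Type*} [CommRing R] [CharP R 2]
    (w : Fin 2 ⊕ Fin 2 → ℕ → R) (t : Fin 2 ⊕ Fin 2) :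
    sympPf w 1 2 3 4 * w t 0 + sympPf w 0 2 3 4 * w t 1 + sympPf w 0 1 3 4 * w t 2
      + sympPf w 0 1 2 4 * w t 3 + sympPf w 0 1 2 3 * w t 4 = 0 := by
  let ω (i j : ℕ) : R :=
    ∑ k : Fin 2, (w (Sum.inr k) i * w (Sum.inl k) j - w (Sum.inl k) i * w (Sum.inr k) j)
  let p (i j k l : ℕ) : R := ω i j * ω k l - ω i k * ω j l + ω i l * ω j k
  have h : p 1 2 3 4 * w t 0 - p 0 2 3 4 * w t 1 + p 0 1 3 4 * w t 2
      - p 0 1 2 4 * w t 3 + p 0 1 2 3 * w t 4 = 0 := by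
    simp only [p, ω, Fin.sum_univ_two]
    rcases t with t | t <;> fin_cases t <;> simp only [Fin.zero_eta, Fin.mk_one] <;> ring
  simpa only [p, ω, sympPf, sympForm, CharTwo.sub_eq_add] using h

/-- Evaluated on the moment curve, the Pfaffian is a Vandermonde determinant. -/
lemma sympPf_moment_curve {R : Type*} [CommRing R] [CharP R 2]
    (w : Fin 2 ⊕ Fin 2 → ℕ → R) (a : ℕ → R)
    (h0 : ∀ i, w (Sum.inr 0) i = 1) (h1 : ∀ i, w (Sum.inl 0) i = a i)
    (h2 : ∀ i, w (Sum.inr 1) i = a i ^ 2) (h3 : ∀ i, w (Sum.inl 1) i = a i ^ 3) :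
    sympPf w 0 1 2 3 = (a 0 - a 1) * (a 0 - a 2) * (a 0 - a 3) * (a 1 - a 2)
      * (a 1 - a 3) * (a 2 - a 3) := by
  let ω (i j : ℕ) : R := 1 * a j - a i * 1 + (a i ^ 2 * a j ^ 3 - a i ^ 3 * a j ^ 2)
  have h : ω 0 1 * ω 2 3 - ω 0 2 * ω 1 3 + ω 0 3 * ω 1 2
      = (a 0 - a 1) * (a 0 - a 2) * (a 0 - a 3) * (a 1 - a 2)
      * (a 1 - a 3) * (a 2 - a 3) := by
    simp only [ω]; ring
  simpa only [sympPf, sympForm, Fin.sum_univ_two, h0, h1, h2, h3, ω, CharTwo.sub_eq_add] using h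

/-- The Frobenius orbit of the vector of variables `x_j, y_j`. -/
noncomputable def frobOrbit (q : ℕ) (F : Type*) [Field F] (t : Fin 2 ⊕ Fin 2) (i : ℕ) :
    MvPolynomial OIdx2 F := X (some t) ^ q ^ i

lemma sympForm_frobOrbit {F : Type*} [Field F] [CharP F 2] (s i j : ℕ) :
    sympForm (frobOrbit (2 ^ s) F) i (i + j) = xiG (2 ^ s) F j ^ (2 ^ s) ^ i := by
  have h (a : MvPolynomial OIdx2 F) : a ^ (2 ^ s) ^ (i + j) = (a ^ (2 ^ s) ^ j) ^ 2 ^ (s * i) := by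
    rw [pow_mul 2 s i, ← pow_mul a, ← pow_add, add_comm]
  rw [xiG, ← pow_mul 2 s i, sum_pow_char_pow]
  refine Finset.sum_congr rfl fun k _ => ?_
  rw [add_pow_char_pow, mul_pow, mul_pow, frobOrbit, frobOrbit, frobOrbit, frobOrbit, h, h, pow_mul]

lemma u2_eq_sympPf {F : Type*} [Field F] [CharP F 2] (s : ℕ) :
    u2 (2 ^ s) F = sympPf (frobOrbit (2 ^ s) F) 0 1 2 3 := by
  have h := sympForm_frobOrbit (F := F) s
  rw [sympPf, h 0 1, h 2 1, h 0 2, h 1 2, h 0 3, h 1 1, u2]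
  ring

lemma u2_ne_zero {F : Type*} [Field F] [CharP F 2] {s : ℕ} (hs : s ≠ 0) :
    u2 (2 ^ s) F ≠ 0 := by
  let φ : MvPolynomial OIdx2 F →ₐ[F] Polynomial F := aeval fun o => o.elim 0
    (Sum.elim ![Polynomial.X, Polynomial.X ^ 3] ![1, Polynomial.X ^ 2])
  have hφ : φ (u2 (2 ^ s) F) = sympPf (fun t i => φ (frobOrbit (2 ^ s) F t i)) 0 1 2 3 := by
    simp only [u2_eq_sympPf, sympPf, sympForm, map_add, map_mul, map_sum]
  have hne {i j : ℕ} (hij : i ≠ j) :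
      (Polynomial.X : Polynomial F) ^ (2 ^ s) ^ i - Polynomial.X ^ (2 ^ s) ^ j ≠ 0 := by
    rw [sub_ne_zero]
    intro h
    have h' := congrArg Polynomial.natDegree h
    rw [Polynomial.natDegree_X_pow, Polynomial.natDegree_X_pow] at h'
    exact hij (Nat.pow_right_injective (Nat.le_self_pow hs 2) h')
  rw [sympPf_moment_curve _ (fun i => Polynomial.X ^ (2 ^ s) ^ i)] at hφ
  · intro h
    rw [h, map_zero] at hφ
    refine absurd hφ.symm ?_
    simp only [mul_ne_zero_iff, ne_eq]
    refine ⟨⟨⟨⟨⟨?_, ?_⟩, ?_⟩, ?_⟩, ?_⟩, ?_⟩ <;> exact hne (by decide)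
  all_goals intro i; simp [φ, frobOrbit, ← pow_mul, mul_comm]

/-- The linear form with coefficient vector `c`. -/
noncomputable def linForm {F : Type*} [Field F] (c : Fin 2 ⊕ Fin 2 → F) : MvPolynomial OIdx2 F :=
  ∑ i, MvPolynomial.C (c i) * X (some i)

lemma linForm_injective {F : Type*} [Field F] :
    Function.Injective (linForm : (Fin 2 ⊕ Fin 2 → F) → MvPolynomial OIdx2 F) := by
  intro c d h
  funext i
  have h' := congrArg (aeval fun o : OIdx2 => if o = some i then (1 : F) else 0) h
  simpa [linForm, -Fintype.sum_sum_type] using h'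

/-- The linearized polynomial of degree `q ^ 4` whose coefficients are the Pfaffian minors. -/
noncomputable def pfPoly (q : ℕ) (F : Type*) [Field F] : Polynomial (MvPolynomial OIdx2 F) :=
  let p := sympPf (frobOrbit q F)
  Polynomial.C (p 1 2 3 4) * Polynomial.X ^ q ^ 0 + Polynomial.C (p 0 2 3 4) * Polynomial.X ^ q ^ 1
    + Polynomial.C (p 0 1 3 4) * Polynomial.X ^ q ^ 2
    + Polynomial.C (p 0 1 2 4) * Polynomial.X ^ q ^ 3
    + Polynomial.C (p 0 1 2 3) * Polynomial.X ^ q ^ 4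

lemma linForm_pow {F : Type*} [Field F] [Fintype F] [CharP F 2] {s : ℕ}
    (hF : Fintype.card F = 2 ^ s) (c : Fin 2 ⊕ Fin 2 → F) (k : ℕ) :
    linForm c ^ (2 ^ s) ^ k = ∑ i, C (c i) * frobOrbit (2 ^ s) F i k := by
  have hc (a : F) : a ^ (2 ^ s) ^ k = a := by rw [← hF, FiniteField.pow_card_pow]
  rw [linForm, ← pow_mul, sum_pow_char_pow]
  simp only [mul_pow, ← C_pow, pow_mul, hc, frobOrbit]

lemma eval_linForm_pfPoly {F : Type*} [Field F] [Fintype F] [CharP F 2] {s : ℕ}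
    (hF : Fintype.card F = 2 ^ s) (c : Fin 2 ⊕ Fin 2 → F) :
    (pfPoly (2 ^ s) F).eval (linForm c) = 0 := by
  simp only [pfPoly, Polynomial.eval_add, Polynomial.eval_mul, Polynomial.eval_C,
    Polynomial.eval_pow, Polynomial.eval_X, linForm_pow hF, Finset.mul_sum,
    ← Finset.sum_add_distrib]
  refine Finset.sum_eq_zero fun i _ => ?_
  linear_combination C (c i) * sympPf_linear_relation (frobOrbit (2 ^ s) F) i

lemma coeff_pfPoly {F : Type*} [Field F] {q : ℕ} (hq : 2 ≤ q) :
    (pfPoly q F).coeff (q ^ 2) = sympPf (frobOrbit q F) 0 1 3 4 ∧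
    (pfPoly q F).coeff (q ^ 3) = sympPf (frobOrbit q F) 0 1 2 4 ∧
    (pfPoly q F).coeff (q ^ 4) = sympPf (frobOrbit q F) 0 1 2 3 := by
  have h (i j : ℕ) : q ^ i = q ^ j ↔ i = j := (Nat.pow_right_injective hq).eq_iff
  simp only [pfPoly, Polynomial.coeff_add, Polynomial.coeff_C_mul, Polynomial.coeff_X_pow, h]
  norm_num

lemma coeff_pfPoly_of_lt {F : Type*} [Field F] {q m : ℕ} (hq : 2 ≤ q) (hm : q ^ 4 < m) :
    (pfPoly q F).coeff m = 0 := by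
  have h {i : ℕ} (hi : i ≤ 4) : m ≠ q ^ i :=
    ((Nat.pow_le_pow_right (by lia) hi).trans_lt hm).ne'
  simp only [pfPoly, Polynomial.coeff_add, Polynomial.coeff_C_mul, Polynomial.coeff_X_pow,
    h (show 0 ≤ 4 by lia), h (show 1 ≤ 4 by lia), h (show 2 ≤ 4 by lia), h (show 3 ≤ 4 by lia),
    h (show 4 ≤ 4 by lia), if_false, mul_zero, add_zero]

lemma pfPoly_eq {F : Type*} [Field F] [Fintype F] [CharP F 2] {s : ℕ} (hs : s ≠ 0)
    (hF : Fintype.card F = 2 ^ s) :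
    pfPoly (2 ^ s) F = Polynomial.C (u2 (2 ^ s) F) * dickP F := by
  have h2 : 2 ≤ 2 ^ s := Nat.le_self_pow hs 2
  have hcard : Fintype.card (Fin 2 ⊕ Fin 2 → F) = (2 ^ s) ^ 4 := by simp [hF]
  have hmonic : (dickP F).Monic :=
    Polynomial.monic_prod_of_monic _ _ fun c _ => Polynomial.monic_X_add_C _
  have hdeg : (dickP F).natDegree = (2 ^ s) ^ 4 := by
    rw [dickP, Polynomial.natDegree_prod_of_monic _ _ fun c _ => Polynomial.monic_X_add_C _]
    simp only [Polynomial.natDegree_X_add_C, Finset.sum_const, Finset.card_univ, hcard, smul_eq_mul,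
      mul_one]
  have hroot (c : Fin 2 ⊕ Fin 2 → F) : (dickP F).eval (linForm c) = 0 := by
    rw [dickP, Polynomial.eval_prod]
    refine Finset.prod_eq_zero (Finset.mem_univ c) ?_
    rw [Polynomial.eval_add, Polynomial.eval_X, Polynomial.eval_C, ← linForm,
      CharTwo.add_self_eq_zero]
  have hlt : (pfPoly (2 ^ s) F - Polynomial.C (u2 (2 ^ s) F) * dickP F).degree
      < ((2 ^ s) ^ 4 : ℕ) := by
    rw [Polynomial.degree_lt_iff_coeff_zero]
    intro m hm
    rw [Polynomial.coeff_sub, Polynomial.coeff_C_mul]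
    rcases hm.eq_or_lt with rfl | hm
    · rw [(coeff_pfPoly h2).2.2, u2_eq_sympPf, ← hdeg, hmonic.coeff_natDegree, mul_one, sub_self]
    · rw [coeff_pfPoly_of_lt h2 hm, Polynomial.coeff_eq_zero_of_natDegree_lt (by rwa [hdeg]),
        mul_zero, sub_zero]
  refine Polynomial.eq_of_degree_sub_lt_of_eval_index_eq (v := linForm) Finset.univ
    linForm_injective.injOn ?_ fun c _ => ?_
  · rwa [Finset.card_univ, hcard]
  · rw [eval_linForm_pfPoly hF, Polynomial.eval_mul, hroot, mul_zero]

/-- The Carlisle–Kropholler symplectic relation. -/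
lemma symplectic_relation {F : Type*} [Field F] [Fintype F] [CharP F 2] {s : ℕ} (hs : s ≠ 0)
    (hF : Fintype.card F = 2 ^ s) :
    xiG (2 ^ s) F 2 ^ 2 ^ s * (dickP F).coeff ((2 ^ s) ^ 3)
        + xiG (2 ^ s) F 1 ^ 2 ^ s * (dickP F).coeff ((2 ^ s) ^ 2)
      = xiG (2 ^ s) F 3 ^ 2 ^ s + xiG (2 ^ s) F 1 * u2 (2 ^ s) F ^ (2 ^ s - 1) := by
  have h2 : 2 ≤ 2 ^ s := Nat.le_self_pow hs 2
  have hform := sympForm_frobOrbit (F := F) s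
  have h0 := u2_eq_sympPf (F := F) s
  have hc3 := (coeff_pfPoly (F := F) h2).2.1
  have hc2 := (coeff_pfPoly (F := F) h2).1
  rw [pfPoly_eq hs hF, Polynomial.coeff_C_mul] at hc2 hc3
  apply mul_left_cancel₀ (u2_ne_zero (F := F) hs)
  have hu : u2 (2 ^ s) F * u2 (2 ^ s) F ^ (2 ^ s - 1) = sympPf (frobOrbit (2 ^ s) F) 1 2 3 4 := by
    rw [← pow_succ', Nat.sub_add_cancel (by lia), u2, add_pow_char_pow, add_pow_char_pow, sympPf,
      hform 1 1, hform 3 1, hform 1 2, hform 2 2, hform 1 3, hform 2 1]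
    ring
  have hx1 : xiG (2 ^ s) F 1 = sympForm (frobOrbit (2 ^ s) F) 0 1 := by simp [hform 0 1]
  have e12 : xiG (2 ^ s) F 1 ^ 2 ^ s = sympForm (frobOrbit (2 ^ s) F) 1 2 := by simp [hform 1 1]
  have e13 : xiG (2 ^ s) F 2 ^ 2 ^ s = sympForm (frobOrbit (2 ^ s) F) 1 3 := by simp [hform 1 2]
  have e14 : xiG (2 ^ s) F 3 ^ 2 ^ s = sympForm (frobOrbit (2 ^ s) F) 1 4 := by simp [hform 1 3]
  rw [mul_add, mul_add, mul_left_comm, hc3, mul_left_comm _ (xiG (2 ^ s) F 1 ^ 2 ^ s), hc2,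
    mul_left_comm _ (xiG (2 ^ s) F 1), hu, h0, e12, e13, e14, hx1]
  simp only [sympPf]
  set ω := sympForm (frobOrbit (2 ^ s) F)
  linear_combination (ω 1 2 * ω 1 3 * ω 0 4 - ω 1 4 * ω 0 1 * ω 2 3)
    * CharTwo.two_eq_zero (R := MvPolynomial OIdx2 F)

/-- The relation
`ξ_3^{q/2} = ξ_2^{q/2} e_1 + ξ_1^{q/2} e_2 + u_2^{q/2-1} ξ_1^{q^2/2+1}`
in the invariant ring of `O_5(F_q)`, where `e_i = u_2^{q/2-1} ξ_i^{q/2} z + b_i`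
with `b_1^2 = d_{1,2} + u_2^{q-2}(ξ_1ξ_2 + ξ̄_0 ξ_1^q)` and
`b_2^2 = d_{2,2} + u_2^{q-2}(ξ_1ξ_3 + ξ̄_0 ξ_2^q)`. -/
theorem stmt_15 {F : Type*} [Field F] [Fintype F] (s q : ℕ) (hs : 2 ≤ s)
    (hq : q = 2 ^ s) (h2 : 2 < q) (hF : Fintype.card F = q)
    (b1 b2 : MvPolynomial OIdx2 F)
    (hb1 : b1 ^ 2 = (dickP F).coeff (q ^ 3)
      + u2 q F ^ (q - 2) * (xiG q F 1 * xiG q F 2 + xiB F * xiG q F 1 ^ q))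
    (hb2 : b2 ^ 2 = (dickP F).coeff (q ^ 2)
      + u2 q F ^ (q - 2) * (xiG q F 1 * xiG q F 3 + xiB F * xiG q F 2 ^ q)) :
    xiG q F 3 ^ 2 ^ (s - 1) =
      xiG q F 2 ^ 2 ^ (s - 1)
          * (u2 q F ^ (2 ^ (s - 1) - 1) * xiG q F 1 ^ 2 ^ (s - 1) * X none + b1)
      + xiG q F 1 ^ 2 ^ (s - 1)
          * (u2 q F ^ (2 ^ (s - 1) - 1) * xiG q F 2 ^ 2 ^ (s - 1) * X none + b2)
      + u2 q F ^ (2 ^ (s - 1) - 1) * xiG q F 1 ^ (2 ^ (2 * s - 1) + 1) := by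
  have : CharP F 2 := charP_of_card_eq_prime_pow (hF.trans hq)
  have hrel := symplectic_relation (F := F) (s := s) (by lia) (hF.trans hq)
  rw [← hq] at hrel
  obtain ⟨n, hn⟩ : ∃ n, 2 ^ (s - 1) = n + 1 :=
    ⟨2 ^ (s - 1) - 1, (Nat.sub_add_cancel Nat.one_le_two_pow).symm⟩
  have hqn : q = 2 * (n + 1) := by
    rw [hq, ← hn, ← pow_succ', Nat.sub_add_cancel (by lia)]
  have hsq : 2 ^ (2 * s - 1) * 2 = q ^ 2 := by
    rw [← pow_succ, hq, ← pow_mul, Nat.sub_add_cancel (by lia), mul_comm]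
  have hu : u2 q F
      = xiG q F 3 * xiG q F 1 ^ q + xiG q F 2 ^ (q + 1) + xiG q F 1 ^ (q ^ 2 + 1) := rfl
  have hq2 : q - 2 = 2 * n := by lia
  have hq1 : q - 1 = 2 * n + 1 := by lia
  have hpow (a : MvPolynomial OIdx2 F) : (a ^ (n + 1)) ^ 2 = a ^ q := by
    rw [← pow_mul, hqn, mul_comm]
  have hpow' (a : MvPolynomial OIdx2 F) :
      (a ^ (2 ^ (2 * s - 1) + 1)) ^ 2 = a ^ q ^ 2 * a ^ 2 := by
    rw [← pow_mul, add_mul, hsq, one_mul, pow_add]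
  rw [hq1] at hrel
  rw [hq2] at hb1 hb2
  rw [pow_succ _ q, pow_succ _ (q ^ 2)] at hu
  rw [hn, Nat.add_sub_cancel, ← CharTwo.sq_inj]
  simp only [CharTwo.add_sq, mul_pow, hpow, hpow', hb1, hb2, ← pow_mul, mul_comm n 2]
  linear_combination -hrel + xiG q F 1 * u2 q F ^ (2 * n) * hu
    - (xiG q F 1 * u2 q F ^ (2 * n + 1)
      + xiG q F 1 ^ q * u2 q F ^ (2 * n) * xiG q F 2 ^ q * (X none ^ 2 + xiB F))
      * CharTwo.two_eq_zero (R := MvPolynomial OIdx2 F)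
end
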